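/- Any derived set of a regular s-interval exchange set with respect to a coding morphism for a set of first return words is again a regular s-interval exchange set. More precisely, let T be a regular s-interval exchange transformation with F = F(T), let w ∈ F, and let f : B* → A* be a coding morphism mapping the alphabet B bijectively onto R_F(w). Then the derived set D_f(F) = f^{-1}(w^{-1}F) equals F(S), where S is the first return map of T on J_w, and S is a regular s-interval exchange transformation. -/

import Mathlib

open Set

/-- An interval exchange transformation on `[l, r)` exchanging `s` half-open
intervals with boundaries `γ 0 = l < γ 1 < … < γ s = r`, translation values `α`,
and permutation `π` (ordering of the image intervals). -/
structure IET (s : ℕ) where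
  l : ℝ
  r : ℝ
  hlr : l < r
  γ : Fin (s + 1) → ℝ
  γ_mono : StrictMono γ
  γ_first : γ 0 = l
  γ_last : γ (Fin.last s) = r
  α : Fin s → ℝ
  π : Equiv.Perm (Fin s)
  T : ℝ → ℝ
  Tinv : ℝ → ℝ
  hT : ∀ i : Fin s, ∀ x ∈ Ico (γ i.castSucc) (γ i.succ), T x = x + α i
  hmaps : MapsTo T (Ico l r) (Ico l r)
  hinv_left : ∀ x ∈ Ico l r, Tinv (T x) = x
  hinv_right : ∀ x ∈ Ico l r, T (Tinv x) = x
  hinvmaps : MapsTo Tinv (Ico l r) (Ico l r)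
  himg_mono : StrictMono fun k : Fin s => γ (Fin.castSucc (π.symm k)) + α (π.symm k)

namespace IET

variable {s : ℕ} (X : IET s)

/-- The `i`-th exchanged interval `I_i`. -/
def I (i : Fin s) : Set ℝ := Ico (X.γ i.castSucc) (X.γ i.succ)

/-- The separation points `γ_1, …, γ_s` (left boundaries of the `I_i`). -/
def sep (i : Fin s) : ℝ := X.γ i.castSucc

/-- `δ i` : left boundary of the image interval `J_i = T(I_i)`. -/
def δ (i : Fin s) : ℝ := X.γ i.castSucc + X.α i

/-- `ℤ`-iterate of the transformation. -/
def iter (n : ℤ) : ℝ → ℝ := if 0 ≤ n then (X.T)^[n.toNat] else (X.Tinv)^[(-n).toNat]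

/-- The two-sided orbit of a point. -/
def orbit (z : ℝ) : Set ℝ := {y | ∃ n : ℤ, X.iter n z = y}

/-- Minimality: every orbit is dense in `[l, r)`. -/
def Minimal : Prop :=
  ∀ z ∈ Ico X.l X.r, ∀ y ∈ Ico X.l X.r, ∀ ε : ℝ, 0 < ε → ∃ w ∈ X.orbit z, |w - y| < ε

/-- Regularity (Keane's idoc condition): the orbits of the nonzero separation
points are infinite and pairwise disjoint. -/
def Regular : Prop :=
  ∀ i j : Fin s, (i : ℕ) ≠ 0 → (j : ℕ) ≠ 0 → ∀ m n : ℤ,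
    X.iter m (X.sep i) = X.iter n (X.sep j) → i = j ∧ m = n

/-- `I_w` : the set of points whose natural coding begins with the word `w`. -/
def Iw (X : IET s) : List (Fin s) → Set ℝ
  | [] => Ico X.l X.r
  | b :: w => X.I b ∩ X.T ⁻¹' (Iw X w)

/-- `J_w = T^{|w|}(I_w)`. -/
def Jw (w : List (Fin s)) : Set ℝ := (X.T)^[w.length] '' X.Iw w

/-- The factor set `F(T)` of the natural codings of `T`. -/
def Fact : Set (List (Fin s)) := {w | (X.Iw w).Nonempty}

/-- First (positive) return time of `z` to the set `J`. -/
noncomputable def retTime (J : Set ℝ) (z : ℝ) : ℕ := sInf {n : ℕ | 0 < n ∧ (X.T)^[n] z ∈ J}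

/-- First return map of `T` on the set `J`. -/
noncomputable def firstReturn (J : Set ℝ) (z : ℝ) : ℝ := (X.T)^[X.retTime J z] z

/-- `ρ⁺_{[u,v),T}(z) = min {n > 0 | T^n z ∈ (u,v)}`. -/
noncomputable def rhoP (u v z : ℝ) : ℕ := sInf {n : ℕ | 0 < n ∧ X.iter n z ∈ Ioo u v}

/-- `ρ⁻_{[u,v),T}(z) = min {n ≥ 0 | T^{-n} z ∈ (u,v)}`. -/
noncomputable def rhoM (u v z : ℝ) : ℕ := sInf {n : ℕ | X.iter (-(n : ℤ)) z ∈ Ioo u v}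

/-- The set of neighbors of `z` with respect to `[u,v)` and `T`. -/
def nbrs (u v z : ℝ) : Set ℝ :=
  {y | ∃ k : ℤ, -(X.rhoM u v z : ℤ) ≤ k ∧ k < (X.rhoP u v z : ℤ) ∧ X.iter k z = y}

/-- The set of division points of `[u,v)` with respect to `T`. -/
def Div (u v : ℝ) : Set ℝ := ⋃ i : Fin s, X.nbrs u v (X.sep i)

/-- A semi-interval `[u,v) ⊆ [l,r)` is admissible for `T` if both of its
endpoints belong to `Div([u,v),T) ∪ {r}`. -/
def Admissible (u v : ℝ) : Prop :=
  X.l ≤ u ∧ u < v ∧ v ≤ X.r ∧ u ∈ X.Div u v ∧ (v ∈ X.Div u v ∨ v = X.r)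

/-- `Y` is (a presentation of) the transformation induced by `X` on `[u,v)`:
its domain is `[u,v)`, it acts as the first return map of `X`, and its
separation points are the division points of `[u,v)` inside `[u,v)`. -/
def InducedOn (Y : IET s) (u v : ℝ) : Prop :=
  Y.l = u ∧ Y.r = v ∧ (∀ z ∈ Ico u v, Y.T z = X.firstReturn (Ico u v) z) ∧
    {y | ∃ i : Fin s, Y.sep i = y} = X.Div u v ∩ Ico u v

end IET

namespace IET

variable {s : ℕ}

/-- The set `Γ_F(w)` of right return words to `w` in `F`. -/
def Gamma (F : Set (List (Fin s))) (w : List (Fin s)) : Set (List (Fin s)) :=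
  {x | x ∈ F ∧ w ++ x ∈ F ∧ ∃ y : List (Fin s), y ≠ [] ∧ w ++ x = y ++ w}

/-- The set `R_F(w) = Γ_F(w) \ Γ_F(w)A⁺` of first right return words to `w`. -/
def RetW (F : Set (List (Fin s))) (w : List (Fin s)) : Set (List (Fin s)) :=
  {x | x ∈ Gamma F w ∧ ∀ p ∈ Gamma F w, ∀ t : List (Fin s), t ≠ [] → x ≠ p ++ t}

end IET

namespace IET
variable {s : ℕ} (X : IET s)

theorem exists_I {z : ℝ} (hz : z ∈ Ico X.l X.r) : ∃ i, z ∈ X.I i := by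
  have key : ∀ k : ℕ, ∀ hk : k < s + 1, z < X.γ ⟨k, hk⟩ → ∃ i, z ∈ X.I i := by
    intro k
    induction k with
    | zero =>
      intro hk h
      have h0 := X.γ_first
      have : X.γ ⟨0, hk⟩ = X.l := h0
      rw [this] at h
      exact absurd hz.1 (not_le.mpr h)
    | succ k ih =>
      intro hk h
      by_cases h1 : z < X.γ ⟨k, by omega⟩
      · exact ih _ h1
      · exact ⟨⟨k, by omega⟩, not_lt.mp h1, h⟩
  refine key s (by omega) ?_
  have := X.γ_last
  have h2 : X.γ ⟨s, by omega⟩ = X.r := this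
  rw [h2]; exact hz.2

theorem I_unique {z : ℝ} {i j : Fin s} (hi : z ∈ X.I i) (hj : z ∈ X.I j) : i = j := by
  by_contra hne
  rcases lt_or_gt_of_ne hne with h | h
  · have : X.γ i.succ ≤ X.γ j.castSucc := X.γ_mono.monotone (by
      rw [Fin.le_def]; simp; exact h)
    exact absurd (hi.2.trans_le (this.trans hj.1)) (lt_irrefl _)
  · have : X.γ j.succ ≤ X.γ i.castSucc := X.γ_mono.monotone (by
      rw [Fin.le_def]; simp; exact h)
    exact absurd (hj.2.trans_le (this.trans hi.1)) (lt_irrefl _)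

theorem I_subset (i : Fin s) : X.I i ⊆ Ico X.l X.r := by
  intro z hz
  refine ⟨?_, ?_⟩
  · rw [← X.γ_first]; exact (X.γ_mono.monotone (Fin.zero_le _)).trans hz.1
  · rw [← X.γ_last]; exact hz.2.trans_le (X.γ_mono.monotone (Fin.le_last _))

theorem γ_lt (i : Fin s) : X.γ i.castSucc < X.γ i.succ := X.γ_mono Fin.castSucc_lt_succ

theorem sep_mem_I (i : Fin s) : X.sep i ∈ X.I i := ⟨le_rfl, X.γ_lt i⟩

theorem sep_mem (i : Fin s) : X.sep i ∈ Ico X.l X.r := X.I_subset i (X.sep_mem_I i)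

theorem sep_zero (i : Fin s) (hi : (i : ℕ) = 0) : X.sep i = X.l := by
  rw [← X.γ_first, sep]
  congr 1
  ext; simpa using hi

theorem sep_gt (i : Fin s) (hi : (i : ℕ) ≠ 0) : X.l < X.sep i := by
  rw [← X.γ_first, sep]
  apply X.γ_mono
  rw [Fin.lt_def]; simp; omega

open Classical in
/-- extension of the transformation to a permutation of the line -/
noncomputable def P : Equiv.Perm ℝ where
  toFun x := if x ∈ Ico X.l X.r then X.T x else x
  invFun x := if x ∈ Ico X.l X.r then X.Tinv x else x
  left_inv x := by
    by_cases h : x ∈ Ico X.l X.r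
    · simp only [if_pos h, if_pos (X.hmaps h), X.hinv_left x h]
    · simp only [if_neg h]
  right_inv x := by
    by_cases h : x ∈ Ico X.l X.r
    · simp only [if_pos h, if_pos (X.hinvmaps h), X.hinv_right x h]
    · simp only [if_neg h]

theorem P_apply {z : ℝ} (hz : z ∈ Ico X.l X.r) : X.P z = X.T z := by
  simp only [P, Equiv.coe_fn_mk, if_pos hz]

theorem P_symm_apply {z : ℝ} (hz : z ∈ Ico X.l X.r) : X.P.symm z = X.Tinv z := by
  simp only [P, Equiv.coe_fn_symm_mk, if_pos hz]

theorem P_mem {z : ℝ} (hz : z ∈ Ico X.l X.r) : X.P z ∈ Ico X.l X.r := by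
  rw [X.P_apply hz]; exact X.hmaps hz

theorem P_symm_mem {z : ℝ} (hz : z ∈ Ico X.l X.r) : X.P.symm z ∈ Ico X.l X.r := by
  rw [X.P_symm_apply hz]; exact X.hinvmaps hz

theorem P_I {i : Fin s} {z : ℝ} (hz : z ∈ X.I i) : X.P z = z + X.α i := by
  rw [X.P_apply (X.I_subset i hz), X.hT i z hz]

theorem Ppow_mem {z : ℝ} (hz : z ∈ Ico X.l X.r) (n : ℕ) : (X.P ^ n) z ∈ Ico X.l X.r := by
  induction n with
  | zero => simpa using hz
  | succ n ih => rw [pow_succ']; exact X.P_mem ih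

theorem Pzpow_mem {z : ℝ} (hz : z ∈ Ico X.l X.r) (n : ℤ) : (X.P ^ n) z ∈ Ico X.l X.r := by
  induction n with
  | zero => simpa using hz
  | succ n ih => rw [add_comm, zpow_add, zpow_one]; exact X.P_mem ih
  | pred n ih =>
    rw [sub_eq_add_neg, add_comm, zpow_add, zpow_neg_one]; exact X.P_symm_mem ih

theorem T_iter {z : ℝ} (hz : z ∈ Ico X.l X.r) (n : ℕ) : X.T^[n] z = (X.P ^ n) z := by
  induction n with
  | zero => simp
  | succ n ih =>
    rw [Function.iterate_succ_apply', ih, pow_succ', Equiv.Perm.mul_apply,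
      X.P_apply (X.Ppow_mem hz n)]

theorem Tinv_iter {z : ℝ} (hz : z ∈ Ico X.l X.r) (n : ℕ) :
    X.Tinv^[n] z = (X.P ^ (-(n : ℤ))) z := by
  induction n with
  | zero => simp
  | succ n ih =>
    have : (-((n + 1 : ℕ) : ℤ)) = -1 + (-(n : ℤ)) := by push_cast; ring
    rw [Function.iterate_succ_apply', ih, this, zpow_add, zpow_neg_one, Equiv.Perm.mul_apply]
    exact (X.P_symm_apply (X.Pzpow_mem hz _)).symm

theorem iter_eq {z : ℝ} (hz : z ∈ Ico X.l X.r) (n : ℤ) : X.iter n z = (X.P ^ n) z := by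
  unfold iter
  split_ifs with h
  · rw [X.T_iter hz, ← zpow_natCast, Int.toNat_of_nonneg h]
  · rw [X.Tinv_iter hz, Int.toNat_of_nonneg (by omega), neg_neg]

theorem reg_P (hreg : X.Regular) {i j : Fin s} (hi : (i : ℕ) ≠ 0) (hj : (j : ℕ) ≠ 0) {m n : ℤ}
    (h : (X.P ^ m) (X.sep i) = (X.P ^ n) (X.sep j)) : i = j ∧ m = n := by
  apply hreg i j hi hj m n
  rw [X.iter_eq (X.sep_mem i), X.iter_eq (X.sep_mem j), h]

/-- words -/
theorem Iw_subset (w : List (Fin s)) : X.Iw w ⊆ Ico X.l X.r := by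
  cases w with
  | nil => exact subset_rfl
  | cons b w => exact fun z hz => X.I_subset b hz.1

theorem mem_Iw_cons {b : Fin s} {w : List (Fin s)} {z : ℝ} :
    z ∈ X.Iw (b :: w) ↔ z ∈ X.I b ∧ X.P z ∈ X.Iw w := by
  constructor
  · rintro ⟨h1, h2⟩
    exact ⟨h1, by rw [X.P_apply (X.I_subset b h1)]; exact h2⟩
  · rintro ⟨h1, h2⟩
    exact ⟨h1, by rw [X.P_apply (X.I_subset b h1)] at h2; exact h2⟩

theorem mem_Iw_append {u v : List (Fin s)} {z : ℝ} :
    z ∈ X.Iw (u ++ v) ↔ z ∈ X.Iw u ∧ (X.P ^ u.length) z ∈ X.Iw v := by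
  induction u generalizing z with
  | nil =>
    simp only [List.nil_append, List.length_nil, pow_zero, Equiv.Perm.coe_one, id_eq]
    exact ⟨fun h => ⟨X.Iw_subset _ h, h⟩, fun h => h.2⟩
  | cons b u ih =>
    rw [List.cons_append, mem_Iw_cons, mem_Iw_cons, ih, List.length_cons, pow_succ,
      Equiv.Perm.mul_apply, and_assoc]

theorem Iw_unique {u v : List (Fin s)} {z : ℝ} (hl : u.length = v.length) (hu : z ∈ X.Iw u)
    (hv : z ∈ X.Iw v) : u = v := by
  induction u generalizing v z with
  | nil => exact (List.length_eq_zero_iff.mp hl.symm).symm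
  | cons b u ih =>
    cases v with
    | nil => simp at hl
    | cons c v =>
      rw [mem_Iw_cons] at hu hv
      rw [X.I_unique hu.1 hv.1, ih (by simpa using hl) hu.2 hv.2]

theorem exists_code {z : ℝ} (hz : z ∈ Ico X.l X.r) (n : ℕ) :
    ∃ x : List (Fin s), x.length = n ∧ z ∈ X.Iw x := by
  induction n generalizing z with
  | zero => exact ⟨[], rfl, hz⟩
  | succ n ih =>
    obtain ⟨i, hi⟩ := X.exists_I hz
    obtain ⟨x, hx, hx2⟩ := ih (X.P_mem hz)
    exact ⟨i :: x, by simp [hx], X.mem_Iw_cons.mpr ⟨hi, hx2⟩⟩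

theorem mem_Jw {w : List (Fin s)} {z : ℝ} :
    z ∈ X.Jw w ↔ (X.P ^ w.length).symm z ∈ X.Iw w := by
  constructor
  · rintro ⟨y, hy, rfl⟩
    rw [X.T_iter (X.Iw_subset _ hy)]
    simpa using hy
  · intro h
    refine ⟨_, h, ?_⟩
    rw [X.T_iter (X.Iw_subset _ h)]
    simp

theorem Jw_subset (w : List (Fin s)) : X.Jw w ⊆ Ico X.l X.r := by
  rintro z ⟨y, hy, rfl⟩
  rw [X.T_iter (X.Iw_subset _ hy)]
  exact X.Ppow_mem (X.Iw_subset _ hy) _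

theorem mem_Jw_Iw {w x : List (Fin s)} {z : ℝ} :
    z ∈ X.Jw w ∧ z ∈ X.Iw x ↔ (X.P ^ w.length).symm z ∈ X.Iw (w ++ x) := by
  rw [mem_Iw_append, mem_Jw]; simp

theorem fact_append_iff {w x : List (Fin s)} :
    w ++ x ∈ X.Fact ↔ ∃ z, z ∈ X.Jw w ∧ z ∈ X.Iw x := by
  constructor
  · rintro ⟨y, hy⟩
    refine ⟨(X.P ^ w.length) y, ?_⟩
    rw [mem_Jw_Iw]; simpa using hy
  · rintro ⟨z, hz⟩
    rw [mem_Jw_Iw] at hz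
    exact ⟨_, hz⟩

theorem gamma_iff {w x : List (Fin s)} {z : ℝ} (hz : z ∈ X.Jw w) (hx : z ∈ X.Iw x) :
    x ∈ Gamma X.Fact w ↔ 0 < x.length ∧ (X.P ^ x.length) z ∈ X.Jw w := by
  have h0 : (X.P ^ w.length).symm z ∈ X.Iw (w ++ x) := X.mem_Jw_Iw.mp ⟨hz, hx⟩
  obtain ⟨y0, rfl⟩ : ∃ y0, z = (X.P ^ w.length) y0 := ⟨(X.P ^ w.length).symm z, by simp⟩
  have hcomm : (X.P ^ x.length) ((X.P ^ w.length) y0) = (X.P ^ w.length) ((X.P ^ x.length) y0) := by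
    rw [← Equiv.Perm.mul_apply, ← Equiv.Perm.mul_apply, ← pow_add, ← pow_add, add_comm]
  rw [hcomm, mem_Jw, Equiv.symm_apply_apply]
  rw [Equiv.symm_apply_apply] at h0
  constructor
  · rintro ⟨-, -, y, hy, he⟩
    have hl : y.length = x.length := by
      have := congrArg List.length he
      simp at this; omega
    refine ⟨by rw [← hl]; exact List.length_pos_iff.mpr hy, ?_⟩
    rw [he, mem_Iw_append, hl] at h0
    exact h0.2
  · rintro ⟨hpos, h⟩
    obtain ⟨y, hy, hy2⟩ := X.exists_code (X.Iw_subset _ h0) x.length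
    refine ⟨⟨_, hx⟩, ⟨_, h0⟩, y, ?_, ?_⟩
    · rintro rfl; simp at hy; omega
    · apply X.Iw_unique _ h0
      · rw [mem_Iw_append, hy]; exact ⟨hy2, h⟩
      · simp [hy, add_comm]

theorem retW_iff {w x : List (Fin s)} {z : ℝ} (hz : z ∈ X.Jw w) (hx : z ∈ X.Iw x) :
    x ∈ RetW X.Fact w ↔ 0 < x.length ∧ (X.P ^ x.length) z ∈ X.Jw w ∧
      ∀ m, 0 < m → m < x.length → (X.P ^ m) z ∉ X.Jw w := by
  constructor
  · rintro ⟨h1, h2⟩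
    have h3 := (X.gamma_iff hz hx).mp h1
    refine ⟨h3.1, h3.2, ?_⟩
    intro m hm hmx hmem
    have hp : z ∈ X.Iw (x.take m) := by
      rw [← List.take_append_drop m x, mem_Iw_append] at hx
      exact hx.1
    have hl : (x.take m).length = m := by simp; omega
    refine h2 (x.take m) ?_ (x.drop m) ?_ (List.take_append_drop m x).symm
    · rw [X.gamma_iff hz hp, hl]; exact ⟨hm, hmem⟩
    · intro h; have := congrArg List.length h; simp at this; omega
  · rintro ⟨h1, h2, h3⟩
    refine ⟨(X.gamma_iff hz hx).mpr ⟨h1, h2⟩, ?_⟩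
    rintro p hp t ht rfl
    rw [mem_Iw_append] at hx
    have h4 := (X.gamma_iff hz hx.1).mp hp
    refine h3 p.length h4.1 ?_ h4.2
    have := List.length_pos_iff.mpr ht
    simp; omega

theorem exists_of_retW {w x : List (Fin s)} (hx : x ∈ RetW X.Fact w) :
    ∃ z, z ∈ X.Jw w ∧ z ∈ X.Iw x := X.fact_append_iff.mp hx.1.2.1

theorem retW_of_return {w : List (Fin s)} {z : ℝ} (hz : z ∈ X.Jw w) {n : ℕ} (hn : 0 < n)
    (h : (X.P ^ n) z ∈ X.Jw w) (hmin : ∀ m, 0 < m → m < n → (X.P ^ m) z ∉ X.Jw w) :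
    ∃ x ∈ RetW X.Fact w, z ∈ X.Iw x ∧ x.length = n := by
  obtain ⟨x, hx, hx2⟩ := X.exists_code (X.Jw_subset _ hz) n
  refine ⟨x, ?_, hx2, hx⟩
  rw [X.retW_iff hz hx2, hx]
  exact ⟨hn, h, hmin⟩

theorem exists_retW_of_return {w : List (Fin s)} {z : ℝ} (hz : z ∈ X.Jw w)
    (h : ∃ n, 0 < n ∧ (X.P ^ n) z ∈ X.Jw w) : ∃ x ∈ RetW X.Fact w, z ∈ X.Iw x := by
  classical
  have h1 := Nat.find_spec h
  obtain ⟨x, hx, hx2, -⟩ := X.retW_of_return hz h1.1 h1.2 (fun m hm hmn hmem =>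
    Nat.find_min h hmn ⟨hm, hmem⟩)
  exact ⟨x, hx, hx2⟩

theorem retW_unique {w x y : List (Fin s)} {z : ℝ} (hz : z ∈ X.Jw w) (hx : x ∈ RetW X.Fact w)
    (hy : y ∈ RetW X.Fact w) (hzx : z ∈ X.Iw x) (hzy : z ∈ X.Iw y) : x = y := by
  have h1 := (X.retW_iff hz hzx).mp hx
  have h2 := (X.retW_iff hz hzy).mp hy
  apply X.Iw_unique _ hzx hzy
  rcases lt_trichotomy x.length y.length with h | h | h
  · exact absurd h1.2.1 (h2.2.2 _ h1.1 h)
  · exact h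
  · exact absurd h2.2.1 (h1.2.2 _ h2.1 h)

theorem retTime_eq {w x : List (Fin s)} {z : ℝ} (hz : z ∈ X.Jw w) (hx : x ∈ RetW X.Fact w)
    (hzx : z ∈ X.Iw x) : X.retTime (X.Jw w) z = x.length := by
  have h1 := (X.retW_iff hz hzx).mp hx
  have hzD := X.Jw_subset _ hz
  unfold retTime
  apply le_antisymm
  · apply Nat.sInf_le
    refine ⟨h1.1, ?_⟩
    rw [X.T_iter hzD]; exact h1.2.1
  · apply le_csInf
    · exact ⟨x.length, h1.1, by rw [X.T_iter hzD]; exact h1.2.1⟩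
    · rintro m ⟨hm, hmem⟩
      rw [X.T_iter hzD] at hmem
      by_contra hlt
      exact h1.2.2 m hm (not_le.mp hlt) hmem

theorem firstReturn_eq {w x : List (Fin s)} {z : ℝ} (hz : z ∈ X.Jw w) (hx : x ∈ RetW X.Fact w)
    (hzx : z ∈ X.Iw x) : X.firstReturn (X.Jw w) z = (X.P ^ x.length) z := by
  unfold firstReturn
  rw [X.retTime_eq hz hx hzx, X.T_iter (X.Jw_subset _ hz)]

/-- intervals -/
theorem Iw_interval (w : List (Fin s)) (hw : w ∈ X.Fact) : ∃ a b t : ℝ, a < b ∧ X.Iw w = Ico a b ∧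
    (∀ z ∈ Ico a b, (X.P ^ w.length) z = z + t) ∧
    ((w = [] ∧ a = X.l) ∨ ∃ n < w.length, ∃ i, (X.P ^ n) a = X.sep i) := by
  induction w with
  | nil => exact ⟨X.l, X.r, 0, X.hlr, rfl, by simp, Or.inl ⟨rfl, rfl⟩⟩
  | cons c w ih =>
    obtain ⟨y, hy⟩ := hw
    rw [mem_Iw_cons] at hy
    obtain ⟨a, b, t, hab, hI, ht, hl⟩ := ih ⟨_, hy.2⟩
    have hset : X.Iw (c :: w) = Ico (max (X.γ c.castSucc) (a - X.α c))
        (min (X.γ c.succ) (b - X.α c)) := by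
      ext z
      rw [mem_Iw_cons, hI]
      constructor
      · rintro ⟨h1, h2⟩
        rw [X.P_I h1] at h2
        exact ⟨max_le h1.1 (by linarith [h2.1]), lt_min h1.2 (by linarith [h2.2])⟩
      · rintro ⟨h1, h2⟩
        have h3 : z ∈ X.I c := ⟨(le_max_left _ _).trans h1, h2.trans_le (min_le_left _ _)⟩
        refine ⟨h3, ?_⟩
        rw [X.P_I h3]
        have h4 := (le_max_right _ _).trans h1
        have h5 := h2.trans_le (min_le_right _ _)
        exact ⟨by linarith, by linarith⟩
    have hy' : y ∈ X.Iw (c :: w) := X.mem_Iw_cons.mpr hy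
    rw [hset] at hy'
    have hlt := hy'.1.trans_lt hy'.2
    refine ⟨_, _, X.α c + t, hlt, hset, ?_, ?_⟩
    · intro z hz
      rw [← hset, mem_Iw_cons, hI] at hz
      rw [List.length_cons, pow_succ, Equiv.Perm.mul_apply, ht _ hz.2, X.P_I hz.1]
      ring
    · right
      by_cases hc : a - X.α c ≤ X.γ c.castSucc
      · exact ⟨0, by simp, c, by rw [max_eq_left hc]; rfl⟩
      · push Not at hc
        have hm : max (X.γ c.castSucc) (a - X.α c) ∈ X.Iw (c :: w) := by
          rw [hset]; exact ⟨le_rfl, hlt⟩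
        rw [mem_Iw_cons] at hm
        have hP := X.P_I hm.1
        rw [max_eq_right hc.le] at hP ⊢
        rw [sub_add_cancel] at hP
        rcases hl with ⟨-, hl⟩ | ⟨n, hn, i, hi⟩
        · have h6 := (X.P_mem (X.sep_mem c)).1
          rw [X.P_I (X.sep_mem_I c)] at h6
          unfold sep at h6
          linarith
        · refine ⟨n + 1, by simpa using hn, i, ?_⟩
          rw [pow_succ, Equiv.Perm.mul_apply, hP, hi]

theorem Jw_interval (w : List (Fin s)) (hw : w ∈ X.Fact) : ∃ u v : ℝ, u < v ∧ X.Jw w = Ico u v ∧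
    (u = X.l ∨ ∃ n : ℕ, 0 < n ∧ ∃ i, u = (X.P ^ n) (X.sep i)) := by
  obtain ⟨a, b, t, hab, hI, ht, hl⟩ := X.Iw_interval w hw
  refine ⟨a + t, b + t, by linarith, ?_, ?_⟩
  · ext z
    constructor
    · rintro ⟨y, hy, rfl⟩
      rw [X.T_iter (X.Iw_subset _ hy)]
      rw [hI] at hy
      rw [ht y hy]
      exact ⟨by linarith [hy.1], by linarith [hy.2]⟩
    · intro hz
      have hy : z - t ∈ Ico a b := ⟨by linarith [hz.1], by linarith [hz.2]⟩
      have hy2 := hy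
      rw [← hI] at hy2
      refine ⟨z - t, hy2, ?_⟩
      rw [X.T_iter (X.Iw_subset _ hy2), ht _ hy]; ring
  · have ha := ht a ⟨le_rfl, hab⟩
    rcases hl with ⟨rfl, h⟩ | ⟨n, hn, i, hi⟩
    · left
      simp at ha
      linarith
    · right
      refine ⟨w.length - n, by omega, i, ?_⟩
      rw [← hi, ← Equiv.Perm.mul_apply, ← pow_add, Nat.sub_add_cancel hn.le, ha]

end IET

namespace IET
variable {s : ℕ} (X : IET s)

open MeasureTheory in
theorem P_measurable : Measurable X.P := by
  classical
  have h : (X.P : ℝ → ℝ) = fun x => x + ∑ i : Fin s, (X.I i).indicator (fun _ => X.α i) x := by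
    funext x
    by_cases hx : x ∈ Ico X.l X.r
    · obtain ⟨i, hi⟩ := X.exists_I hx
      rw [X.P_I hi, Finset.sum_eq_single i]
      · rw [indicator_of_mem hi]
      · intro j _ hj
        exact indicator_of_notMem (fun h => hj (X.I_unique h hi)) _
      · simp
    · rw [Finset.sum_eq_zero]
      · simp only [P, Equiv.coe_fn_mk, if_neg hx, add_zero]
      · intro j _
        exact indicator_of_notMem (fun h => hx (X.I_subset j h)) _
  rw [h]
  apply measurable_id.add
  apply Finset.measurable_sum
  intro i _
  exact measurable_const.indicator measurableSet_Ico

open MeasureTheory in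
theorem P_measurePreserving :
    MeasurePreserving X.P (volume.restrict (Ico X.l X.r)) (volume.restrict (Ico X.l X.r)) := by
  refine ⟨X.P_measurable, ?_⟩
  ext A hA
  rw [Measure.map_apply X.P_measurable hA, Measure.restrict_apply (X.P_measurable hA),
    Measure.restrict_apply hA]
  have hmeas : ∀ i : Fin s, MeasurableSet (X.I i ∩ (fun x => x + X.α i) ⁻¹' A) := fun i =>
    measurableSet_Ico.inter (measurable_id.add_const _ hA)
  have h1 : X.P ⁻¹' A ∩ Ico X.l X.r = ⋃ i : Fin s, X.I i ∩ (fun x => x + X.α i) ⁻¹' A := by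
    ext z
    simp only [mem_inter_iff, mem_preimage, mem_iUnion]
    constructor
    · rintro ⟨h, hz⟩
      obtain ⟨i, hi⟩ := X.exists_I hz
      exact ⟨i, hi, by rwa [← X.P_I hi]⟩
    · rintro ⟨i, hi, h⟩
      exact ⟨by rwa [X.P_I hi], X.I_subset i hi⟩
  have h2 : A ∩ Ico X.l X.r = ⋃ i : Fin s,
      (fun x => x + (-X.α i)) ⁻¹' (X.I i ∩ (fun x => x + X.α i) ⁻¹' A) := by
    ext z
    simp only [mem_inter_iff, mem_preimage, mem_iUnion]
    constructor
    · rintro ⟨h, hz⟩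
      obtain ⟨i, hi⟩ := X.exists_I (X.P_symm_mem hz)
      have h3 := X.P_I hi
      rw [Equiv.apply_symm_apply] at h3
      have h4 : z + -X.α i = X.P.symm z := by linarith
      refine ⟨i, by rwa [h4], ?_⟩
      simpa using h
    · rintro ⟨i, hi, h⟩
      have h3 := X.P_I hi
      have h4 : z + -X.α i + X.α i = z := by ring
      rw [h4] at h h3
      exact ⟨h, by rw [← h3]; exact X.P_mem (X.I_subset i hi)⟩
  rw [h1, h2, measure_iUnion _ hmeas, measure_iUnion]
  · congr 1
    funext i
    rw [measure_preimage_add_right]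
  · intro i j hij
    rw [Function.onFun, Set.disjoint_left]
    rintro z ⟨h3, -⟩ ⟨h4, -⟩
    have h5 := X.P_I h3
    have h6 := X.P_I h4
    simp only [neg_add_cancel_right] at h5 h6
    have h7 := X.P.injective (h5.trans h6.symm)
    have h8 : z + -X.α i ∈ X.I i := h3
    rw [h7] at h8
    exact hij (X.I_unique h8 h4)
  · intro i
    exact measurable_id.add_const _ (hmeas i)
  · intro i j hij
    rw [Function.onFun, Set.disjoint_left]
    rintro z ⟨h3, -⟩ ⟨h4, -⟩
    exact hij (X.I_unique h3 h4)

open MeasureTheory in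
theorem recur {a b : ℝ} (hab : a < b) (hsub : Ico a b ⊆ Ico X.l X.r) :
    ∃ q ∈ Ico a b, ∃ n : ℕ, 0 < n ∧ (X.P ^ n) q ∈ Ico a b := by
  have hc := X.P_measurePreserving.conservative
  obtain ⟨q, hq, n, hn, h⟩ := hc.exists_mem_iterate_mem (s := Ico a b)
    measurableSet_Ico.nullMeasurableSet (by
      rw [Measure.restrict_apply measurableSet_Ico, inter_eq_left.mpr hsub, Real.volume_Ico]
      simp [hab])
  refine ⟨q, hq, n, Nat.pos_of_ne_zero hn, ?_⟩
  rwa [Equiv.Perm.iterate_eq_pow] at h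

theorem pred_sep {y : ℝ} {i : Fin s} (hy : y ∈ X.I i) (hne : y ≠ X.sep i) :
    y ∈ Ioo (X.γ i.castSucc) (X.γ i.succ) := ⟨lt_of_le_of_ne hy.1 (Ne.symm hne), hy.2⟩

/-- the left end point is the image of a nonzero separation point -/
theorem exists_l (hs : 2 ≤ s) (hreg : X.Regular) : ∃ j : Fin s, (j : ℕ) ≠ 0 ∧
    X.P (X.sep j) = X.l := by
  have hl : X.l ∈ Ico X.l X.r := ⟨le_rfl, X.hlr⟩
  obtain ⟨j, hj⟩ := X.exists_I (X.P_symm_mem hl)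
  have hP := X.P_I hj
  rw [Equiv.apply_symm_apply] at hP
  have hjs : X.P (X.sep j) = X.l := by
    have h1 := (X.P_mem (X.sep_mem j)).1
    rw [X.P_I (X.sep_mem_I j)] at h1 ⊢
    have : X.sep j ≤ X.P.symm X.l := hj.1
    linarith
  by_cases hj0 : (j : ℕ) = 0
  · exfalso
    rw [X.sep_zero j hj0] at hjs
    have hα : X.α j = 0 := by
      have := X.P_I (X.sep_mem_I j)
      rw [X.sep_zero j hj0, hjs] at this
      linarith
    let k : Fin s := ⟨1, by omega⟩
    have hk : (k : ℕ) ≠ 0 := by simp [k]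
    have hkj : X.γ j.succ = X.sep k := by
      unfold sep; congr 1; ext; simp [k, hj0]
    obtain ⟨i, hi⟩ := X.exists_I (X.P_symm_mem (X.sep_mem k))
    have hPi := X.P_I hi
    rw [Equiv.apply_symm_apply] at hPi
    have hij : i ≠ j := by
      rintro rfl
      have := hi.2
      rw [hkj] at this
      rw [hα] at hPi
      linarith
    by_cases hy : X.P.symm (X.sep k) = X.sep i
    · have hi0 : (i : ℕ) ≠ 0 := fun h => hij (Fin.ext (by omega))
      have h1 : X.P (X.sep i) = X.sep k := by rw [← hy]; simp
      have := X.reg_P hreg hi0 hk (m := 1) (n := 0) (by simpa using h1)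
      exact absurd this.2 (by norm_num)
    · have hy2 := X.pred_sep hi hy
      -- a point slightly below
      obtain ⟨y, hy3, hy4⟩ := exists_between
        (max_lt hy2.1 (show X.P.symm (X.sep k) - (X.sep k - X.l) < X.P.symm (X.sep k) by
          linarith [X.sep_gt k hk]))
      have hyI : y ∈ X.I i := ⟨((le_max_left _ _).trans_lt hy3).le, hy4.trans hy2.2⟩
      have h5 := (le_max_right _ _).trans_lt hy3
      have hyP := X.P_I hyI
      have hmem : X.P y ∈ X.I j := by
        refine ⟨?_, ?_⟩
        · have := X.sep_zero j hj0
          unfold sep at this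
          rw [this, hyP]; linarith
        · rw [hkj, hyP]; linarith
      have h6 := X.P_I hmem
      rw [hα, add_zero] at h6
      have h7 := X.P.injective h6
      rw [h7] at hmem
      exact hij (X.I_unique hyI hmem)
  · exact ⟨j, hj0, hjs⟩

/-- every separation point lies in the forward orbit of a nonzero one -/
theorem sep_orbit (hs : 2 ≤ s) (hreg : X.Regular) (i : Fin s) : ∃ j : Fin s, (j : ℕ) ≠ 0 ∧
    ∃ k : ℕ, (X.P ^ k) (X.sep j) = X.sep i := by
  by_cases hi : (i : ℕ) = 0
  · obtain ⟨j, hj, h⟩ := X.exists_l hs hreg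
    exact ⟨j, hj, 1, by rw [pow_one, h, X.sep_zero i hi]⟩
  · exact ⟨i, hi, 0, by simp⟩

theorem no_periodic (hs : 2 ≤ s) (hreg : X.Regular) {z : ℝ} (hz : z ∈ Ico X.l X.r) {n : ℕ}
    (hn : 0 < n) : (X.P ^ n) z ≠ z := by
  intro h
  obtain ⟨x, hx, hzx⟩ := X.exists_code hz n
  obtain ⟨a, b, t, hab, hI, ht, hl⟩ := X.Iw_interval x ⟨z, hzx⟩
  rw [hx] at ht
  have h1 := ht z (hI ▸ hzx)
  have h2 := ht a ⟨le_rfl, hab⟩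
  have h3 : (X.P ^ n) a = a := by linarith
  have h4 : ∃ k, ∃ i, (X.P ^ k) a = X.sep i := by
    rcases hl with ⟨h5, -⟩ | ⟨k, -, i, hi⟩
    · subst h5; simp at hx; omega
    · exact ⟨k, i, hi⟩
  obtain ⟨k, i, hi⟩ := h4
  obtain ⟨j, hj, m, hm⟩ := X.sep_orbit hs hreg i
  have h5 : (X.P ^ n) (X.sep i) = X.sep i := by
    rw [← hi, ← Equiv.Perm.mul_apply, ← pow_add, add_comm, pow_add, Equiv.Perm.mul_apply, h3]
  have h6 : (X.P ^ ((n + m : ℕ) : ℤ)) (X.sep j) = (X.P ^ (m : ℤ)) (X.sep j) := by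
    rw [zpow_natCast, zpow_natCast, pow_add, Equiv.Perm.mul_apply, hm, h5]
  have := (X.reg_P hreg hj hj h6).2
  push_cast at this
  omega

/-- right neighbourhoods -/
theorem right_nhd {ι : Type} [Finite ι] (a b : ι → ℝ) {z : ℝ} (hz : ∀ i, z ∉ Ico (a i) (b i))
    {v : ℝ} (hv : z < v) :
    ∃ y, z < y ∧ y ≤ v ∧ ∀ q ∈ Ico z y, ∀ i, q ∉ Ico (a i) (b i) := by
  have h : ∀ i, ∀ᶠ q in nhdsWithin z (Ici z), q ∉ Ico (a i) (b i) := by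
    intro i
    by_cases h1 : z < a i
    · filter_upwards [mem_nhdsWithin_of_mem_nhds (Iio_mem_nhds h1)] with q hq hq2
      exact absurd hq2.1 (not_le.mpr hq)
    · filter_upwards [self_mem_nhdsWithin] with q hq hq2
      exact hz i ⟨not_lt.mp h1, lt_of_le_of_lt hq hq2.2⟩
  have h2 := Filter.eventually_all.mpr h
  rw [Filter.Eventually, mem_nhdsGE_iff_exists_Ico_subset] at h2
  obtain ⟨y, hy, hy2⟩ := h2
  refine ⟨min y v, lt_min hy hv, min_le_right _ _, ?_⟩
  intro q hq
  exact hy2 ⟨hq.1, hq.2.trans_le (min_le_left _ _)⟩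

end IET

namespace IET
variable {s : ℕ} (X : IET s)

theorem pow_cancel {n m : ℕ} {p q : ℝ} (h : (X.P ^ n) p = (X.P ^ m) q) (hnm : n ≤ m) :
    p = (X.P ^ (m - n)) q := by
  apply (X.P ^ n).injective
  rw [h, ← Equiv.Perm.mul_apply, ← pow_add, Nat.add_sub_cancel' hnm]

theorem reg_nat (hreg : X.Regular) {i j : Fin s} (hi : (i : ℕ) ≠ 0) (hj : (j : ℕ) ≠ 0) {m n : ℕ}
    (h : (X.P ^ m) (X.sep i) = (X.P ^ n) (X.sep j)) : i = j ∧ m = n := by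
  have := X.reg_P hreg hi hj (m := (m : ℤ)) (n := (n : ℤ)) (by simpa using h)
  exact ⟨this.1, by exact_mod_cast this.2⟩

/-- all data attached to the induction on `J_w` -/
structure Setup (X : IET s) (w : List (Fin s)) where
  hs : 2 ≤ s
  hreg : X.Regular
  u : ℝ
  v : ℝ
  huv : u < v
  hJ : X.Jw w = Ico u v
  hu : ∃ k : ℕ, 0 < k ∧ ∃ j : Fin s, (j : ℕ) ≠ 0 ∧ u = (X.P ^ k) (X.sep j)
  a : {x // x ∈ RetW X.Fact w} → ℝ
  b : {x // x ∈ RetW X.Fact w} → ℝ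
  hab : ∀ x, a x < b x
  hK : ∀ x : {x // x ∈ RetW X.Fact w}, X.Jw w ∩ X.Iw x.1 = Ico (a x) (b x)
  hleft : ∀ x, a x = u ∨ ∃ n < x.1.length, ∃ i : Fin s, (i : ℕ) ≠ 0 ∧ (X.P ^ n) (a x) = X.sep i

theorem exists_setup (hs : 2 ≤ s) (hreg : X.Regular) (w : List (Fin s)) (hw : w ∈ X.Fact) :
    Nonempty (Setup X w) := by
  obtain ⟨u, v, huv, hJ, hu⟩ := X.Jw_interval w hw
  have huD : u ∈ Ico X.l X.r := X.Jw_subset w (by rw [hJ]; exact ⟨le_rfl, huv⟩)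
  have hu' : ∃ k : ℕ, 0 < k ∧ ∃ j : Fin s, (j : ℕ) ≠ 0 ∧ u = (X.P ^ k) (X.sep j) := by
    rcases hu with h | ⟨n, hn, i, hi⟩
    · obtain ⟨j, hj, h2⟩ := X.exists_l hs hreg
      exact ⟨1, one_pos, j, hj, by rw [pow_one, h2, h]⟩
    · obtain ⟨j, hj, k, hk⟩ := X.sep_orbit hs hreg i
      refine ⟨n + k, by omega, j, hj, ?_⟩
      rw [pow_add, Equiv.Perm.mul_apply, hk, hi]
  have key : ∀ x : {x // x ∈ RetW X.Fact w}, ∃ a b : ℝ, a < b ∧ X.Jw w ∩ X.Iw x.1 = Ico a b ∧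
      (a = u ∨ ∃ n < x.1.length, ∃ i : Fin s, (i : ℕ) ≠ 0 ∧ (X.P ^ n) a = X.sep i) := by
    rintro ⟨x, hx⟩
    obtain ⟨y, hy1, hy2⟩ := X.exists_of_retW hx
    obtain ⟨a, b, t, hab, hI, ht, hl⟩ := X.Iw_interval x ⟨y, hy2⟩
    have hset : X.Jw w ∩ X.Iw x = Ico (max u a) (min v b) := by
      rw [hJ, hI, Ico_inter_Ico]
    have hy : y ∈ Ico (max u a) (min v b) := by rw [← hset]; exact ⟨hy1, hy2⟩
    refine ⟨_, _, hy.1.trans_lt hy.2, hset, ?_⟩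
    by_cases hau : a ≤ u
    · left; exact max_eq_left hau
    · right
      push Not at hau
      rw [max_eq_right hau.le]
      have hxl := ((X.retW_iff hy1 hy2).mp hx).1
      rcases hl with ⟨rfl, -⟩ | ⟨n, hn, i, hi⟩
      · simp at hxl
      · by_cases hi0 : (i : ℕ) = 0
        · rw [X.sep_zero i hi0] at hi
          obtain ⟨j, hj, h2⟩ := X.exists_l hs hreg
          cases n with
          | zero =>
            simp at hi
            have := huD.1
            linarith
          | succ n =>
            refine ⟨n, by change n < x.length; omega, j, hj, ?_⟩
            rw [pow_succ', Equiv.Perm.mul_apply, ← h2] at hi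
            exact X.P.injective hi
        · exact ⟨n, hn, i, hi0, hi⟩
  choose a b h1 h2 h3 using key
  exact ⟨⟨hs, hreg, u, v, huv, hJ, hu', a, b, h1, h2, h3⟩⟩

namespace Setup
variable {X} {w : List (Fin s)} (D : Setup X w)

theorem mem_K {x : {x // x ∈ RetW X.Fact w}} {z : ℝ} :
    z ∈ Ico (D.a x) (D.b x) ↔ z ∈ X.Jw w ∧ z ∈ X.Iw x.1 := by
  rw [← D.hK]; rfl

theorem a_mem (x : {x // x ∈ RetW X.Fact w}) : D.a x ∈ Ico (D.a x) (D.b x) := ⟨le_rfl, D.hab x⟩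

theorem K_unique {x y : {x // x ∈ RetW X.Fact w}} {z : ℝ} (hx : z ∈ Ico (D.a x) (D.b x))
    (hy : z ∈ Ico (D.a y) (D.b y)) : x = y := by
  rw [D.mem_K] at hx hy
  exact Subtype.ext (X.retW_unique hx.1 x.2 y.2 hx.2 hy.2)

theorem K_ret {x : {x // x ∈ RetW X.Fact w}} {z : ℝ} (hx : z ∈ Ico (D.a x) (D.b x)) :
    0 < x.1.length ∧ (X.P ^ x.1.length) z ∈ X.Jw w ∧
      ∀ m, 0 < m → m < x.1.length → (X.P ^ m) z ∉ X.Jw w := by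
  rw [D.mem_K] at hx
  exact (X.retW_iff hx.1 hx.2).mp x.2

theorem u_mem : D.u ∈ X.Jw w := by rw [D.hJ]; exact ⟨le_rfl, D.huv⟩

theorem u_not_hit {n : ℕ} {i : Fin s} (hi : (i : ℕ) ≠ 0) : (X.P ^ n) D.u ≠ X.sep i := by
  intro h
  obtain ⟨k, hk, j, hj, hu⟩ := D.hu
  rw [hu, ← Equiv.Perm.mul_apply, ← pow_add] at h
  have := (X.reg_nat D.hreg hj hi (n := 0) (by simpa using h)).2
  omega

theorem same_hit {x y : {x // x ∈ RetW X.Fact w}} {p q : ℝ} (hp : p ∈ Ico (D.a x) (D.b x))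
    (hq : q ∈ Ico (D.a y) (D.b y)) {n m : ℕ} (hn : n < x.1.length) (hm : m < y.1.length)
    (h : (X.P ^ n) p = (X.P ^ m) q) : p = q := by
  have hp' := (D.mem_K.mp hp).1
  have hq' := (D.mem_K.mp hq).1
  rcases lt_trichotomy n m with h1 | h1 | h1
  · have h2 := X.pow_cancel h h1.le
    rw [h2] at hp'
    exact absurd hp' ((D.K_ret hq).2.2 _ (by omega) (by omega))
  · subst h1; exact (X.P ^ n).injective h
  · have h2 := X.pow_cancel h.symm h1.le
    rw [h2] at hq'
    exact absurd hq' ((D.K_ret hp).2.2 _ (by omega) (by omega))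

theorem a_inj : Function.Injective D.a := by
  intro x y h
  have h1 := D.a_mem x
  rw [h] at h1
  exact D.K_unique (z := D.a y) (by rw [h]; exact h1) (D.a_mem y)

theorem exists_phi : ∃ φ : {x // x ∈ RetW X.Fact w} → Fin s, Function.Injective φ ∧
    (∀ x, D.a x = D.u → (φ x : ℕ) = 0) ∧
    (∀ x, D.a x ≠ D.u → (φ x : ℕ) ≠ 0 ∧ ∃ n < x.1.length, (X.P ^ n) (D.a x) = X.sep (φ x)) := by
  classical
  have hs := D.hs
  have key : ∀ x : {x // x ∈ RetW X.Fact w}, ∃ i : Fin s, (D.a x = D.u → (i : ℕ) = 0) ∧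
      (D.a x ≠ D.u → (i : ℕ) ≠ 0 ∧ ∃ n < x.1.length, (X.P ^ n) (D.a x) = X.sep i) := by
    intro x
    by_cases h : D.a x = D.u
    · exact ⟨⟨0, by omega⟩, fun _ => rfl, fun h' => absurd h h'⟩
    · obtain ⟨n, hn, i, hi, h2⟩ := (D.hleft x).resolve_left h
      exact ⟨i, fun h' => absurd h' h, fun _ => ⟨hi, n, hn, h2⟩⟩
  choose φ h0 h1 using key
  refine ⟨φ, ?_, h0, h1⟩
  intro x y hxy
  by_cases hx : D.a x = D.u <;> by_cases hy : D.a y = D.u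
  · exact D.a_inj (hx.trans hy.symm)
  · exact absurd (by rw [← hxy]; exact h0 x hx) (h1 y hy).1
  · exact absurd (by rw [hxy]; exact h0 y hy) (h1 x hx).1
  · obtain ⟨-, n, hn, h2⟩ := h1 x hx
    obtain ⟨-, m, hm, h3⟩ := h1 y hy
    apply D.a_inj
    exact D.same_hit (D.a_mem x) (D.a_mem y) hn hm (by rw [h2, h3, hxy])

theorem finite_R (D : Setup X w) : Finite {x // x ∈ RetW X.Fact w} := by
  obtain ⟨φ, hφ, -⟩ := D.exists_phi
  exact Finite.of_injective φ hφ

theorem translate (x : {x // x ∈ RetW X.Fact w}) (m : ℕ) (hm : m ≤ x.1.length) :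
    ∃ t : ℝ, ∀ z ∈ Ico (D.a x) (D.b x), (X.P ^ m) z = z + t := by
  have htake : ∀ z ∈ Ico (D.a x) (D.b x), z ∈ X.Iw (x.1.take m) := by
    intro z hz
    have h := (D.mem_K.mp hz).2
    rw [← List.take_append_drop m x.1, mem_Iw_append] at h
    exact h.1
  obtain ⟨a, b, t, hab, hI, ht, -⟩ := X.Iw_interval (x.1.take m) ⟨_, htake _ (D.a_mem x)⟩
  refine ⟨t, fun z hz => ?_⟩
  have h := ht z (by rw [← hI]; exact htake z hz)
  rwa [List.length_take, min_eq_left hm] at h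

theorem floor (x : {x // x ∈ RetW X.Fact w}) (m : ℕ) (hm : m ≤ x.1.length) :
    ∃ p : ℝ × ℝ, p.1 < p.2 ∧ (X.P ^ m) '' Ico (D.a x) (D.b x) = Ico p.1 p.2 := by
  obtain ⟨t, ht⟩ := D.translate x m hm
  refine ⟨(D.a x + t, D.b x + t), by have := D.hab x; simpa using this, ?_⟩
  ext z
  constructor
  · rintro ⟨y, hy, rfl⟩
    rw [ht y hy]
    exact ⟨by linarith [hy.1], by linarith [hy.2]⟩
  · rintro ⟨h1, h2⟩
    simp only at h1 h2
    have hy : z - t ∈ Ico (D.a x) (D.b x) := ⟨by linarith, by linarith⟩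
    exact ⟨z - t, hy, by rw [ht _ hy]; ring⟩

theorem returns {z : ℝ} (hz : z ∈ X.Jw w) : ∃ x, z ∈ Ico (D.a x) (D.b x) := by
  by_contra hno
  push Not at hno
  have := D.finite_R
  have hz' := hz
  rw [D.hJ] at hz'
  obtain ⟨y, hy, hyv, hq⟩ := right_nhd D.a D.b hno hz'.2
  have hsubJ : Ico z y ⊆ X.Jw w := by
    intro q hq; rw [D.hJ]; exact ⟨hz'.1.trans hq.1, hq.2.trans_le hyv⟩
  obtain ⟨q, hq1, n, hn, hq2⟩ := X.recur hy (hsubJ.trans (X.Jw_subset w))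
  obtain ⟨x, hx, hqx⟩ := X.exists_retW_of_return (hsubJ hq1) ⟨n, hn, hsubJ hq2⟩
  exact hq q hq1 ⟨x, hx⟩ (D.mem_K.mpr ⟨hsubJ hq1, hqx⟩)

/-- the last visit before `z` exhibits `z` in the tower -/
theorem tower {z : ℝ} {n : ℕ} {y : ℝ} (hy : y ∈ X.Jw w) (h : (X.P ^ n) y = z)
    (hmin : ∀ m, m < n → ∀ y' ∈ X.Jw w, (X.P ^ m) y' = z → m = 0) (hn : 0 < n)
    : ∃ x, y ∈ Ico (D.a x) (D.b x) ∧ n ≤ x.1.length := by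
  obtain ⟨x, hx⟩ := D.returns hy
  refine ⟨x, hx, ?_⟩
  by_contra hlt
  push Not at hlt
  have h1 := D.K_ret hx
  have := hmin (n - x.1.length) (by omega) _ h1.2.1 (by
    rw [← Equiv.Perm.mul_apply, ← pow_add, Nat.sub_add_cancel hlt.le, h])
  omega

theorem back {z : ℝ} (hz : z ∈ X.Jw w) :
    ∃ x, ∃ y ∈ Ico (D.a x) (D.b x), (X.P ^ x.1.length) y = z := by
  classical
  by_contra hno
  push Not at hno
  have := D.finite_R
  choose p hp1 hp2 using fun x : {x // x ∈ RetW X.Fact w} => D.floor x x.1.length le_rfl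
  have hz' := hz
  rw [D.hJ] at hz'
  obtain ⟨y, hy, hyv, hq⟩ := right_nhd (fun x => (p x).1) (fun x => (p x).2) (z := z) (by
    intro x; rw [← hp2]; rintro ⟨q, hq, hq2⟩; exact hno x q hq hq2) hz'.2
  have hsubJ : Ico z y ⊆ X.Jw w := by
    intro q hq; rw [D.hJ]; exact ⟨hz'.1.trans hq.1, hq.2.trans_le hyv⟩
  obtain ⟨q, hq1, n, hn, hq2⟩ := X.recur hy (hsubJ.trans (X.Jw_subset w))
  set q' := (X.P ^ n) q with hq'
  have hex : ∃ n, 0 < n ∧ ∃ y ∈ X.Jw w, (X.P ^ n) y = q' := ⟨n, hn, q, hsubJ hq1, rfl⟩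
  obtain ⟨hm, y', hy', hy2⟩ := Nat.find_spec hex
  have hmin : ∀ m, m < Nat.find hex → ∀ y' ∈ X.Jw w, (X.P ^ m) y' = q' → m = 0 := by
    intro m hm y'' hy'' h
    by_contra hm0
    exact Nat.find_min hex hm ⟨Nat.pos_of_ne_zero hm0, y'', hy'', h⟩
  obtain ⟨x, hx, hle⟩ := D.tower hy' hy2 hmin hm
  have heq : Nat.find hex = x.1.length := by
    rcases hle.lt_or_eq with h | h
    · exact absurd (by rw [hy2]; exact hsubJ hq2) ((D.K_ret hx).2.2 _ hm h)
    · exact h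
  rw [heq] at hy2
  refine hq q' hq2 x ?_
  rw [← hp2]
  exact ⟨y', hx, hy2⟩

theorem back_far (D : Setup X w) {z : ℝ} (hz : z ∈ X.Jw w) (N : ℕ) :
    ∃ m, N ≤ m ∧ ∃ y ∈ X.Jw w, (X.P ^ m) y = z := by
  induction N with
  | zero => exact ⟨0, le_rfl, z, hz, rfl⟩
  | succ N ih =>
    obtain ⟨m, hm, y, hy, h⟩ := ih
    obtain ⟨x, y', hy', h'⟩ := D.back hy
    refine ⟨m + x.1.length, ?_, y', (D.mem_K.mp hy').1, ?_⟩
    · have := (D.K_ret hy').1; omega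
    · rw [pow_add, Equiv.Perm.mul_apply, h', h]

/-- the invariant set generated by `J_w` -/
def Z (_ : Setup X w) : Set ℝ := {z | ∃ n : ℤ, (X.P ^ n) z ∈ X.Jw w}

theorem Z_inv (z : ℝ) : X.P z ∈ D.Z ↔ z ∈ D.Z := by
  constructor
  · rintro ⟨n, hn⟩
    exact ⟨n + 1, by rw [zpow_add, zpow_one]; exact hn⟩
  · rintro ⟨n, hn⟩
    refine ⟨n - 1, ?_⟩
    rw [← Equiv.Perm.mul_apply, ← zpow_add_one, sub_add_cancel]; exact hn

theorem Z_tower {z : ℝ} (hz : z ∈ D.Z) :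
    ∃ x, ∃ n < x.1.length, ∃ y ∈ Ico (D.a x) (D.b x), (X.P ^ n) y = z := by
  classical
  have hex : ∃ n : ℕ, ∃ y ∈ X.Jw w, (X.P ^ n) y = z := by
    obtain ⟨n, hn⟩ := hz
    obtain ⟨m, hm, y, hy, h⟩ := D.back_far hn n.toNat
    refine ⟨((m : ℤ) - n).toNat, y, hy, ?_⟩
    apply (X.P ^ n).injective
    rw [← h, ← zpow_natCast, ← zpow_natCast, ← Equiv.Perm.mul_apply, ← zpow_add]
    congr 2
    omega
  obtain ⟨y, hy, h⟩ := Nat.find_spec hex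
  obtain ⟨x, hx⟩ := D.returns hy
  refine ⟨x, Nat.find hex, ?_, y, hx, h⟩
  by_contra hlt
  push Not at hlt
  have h1 := D.K_ret hx
  refine Nat.find_min hex (m := Nat.find hex - x.1.length) (by omega) ⟨_, h1.2.1, ?_⟩
  rw [← Equiv.Perm.mul_apply, ← pow_add, Nat.sub_add_cancel hlt, h]

end Setup
end IET

namespace IET
namespace Setup
variable {s : ℕ} {X : IET s} {w : List (Fin s)} (D : Setup X w)

/-- boundary points of `Z` -/
def E : Set ℝ := {e | e ∈ Ioo X.l X.r ∧ ¬ ∀ᶠ y in nhds e, (y ∈ D.Z ↔ e ∈ D.Z)}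

theorem Ico_loc {a b e : ℝ} (ha : e ≠ a) (hb : e ≠ b) :
    ∀ᶠ y in nhds e, (y ∈ Ico a b ↔ e ∈ Ico a b) := by
  rcases lt_or_gt_of_ne ha with h | h
  · filter_upwards [Iio_mem_nhds h] with y hy
    exact ⟨fun h' => absurd h'.1 (not_le.mpr hy), fun h' => absurd h'.1 (not_le.mpr h)⟩
  · rcases lt_or_gt_of_ne hb with h2 | h2
    · filter_upwards [Iio_mem_nhds h2, Ioi_mem_nhds h] with y hy hy2
      exact ⟨fun _ => ⟨h.le, h2⟩, fun _ => ⟨le_of_lt hy2, hy⟩⟩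
    · filter_upwards [Ioi_mem_nhds h2] with y hy
      exact ⟨fun h' => absurd h'.2 (not_lt.mpr (le_of_lt hy)),
        fun h' => absurd h'.2 (not_lt.mpr h2.le)⟩

theorem E_finite : D.E.Finite := by
  have := D.finite_R
  have key : ∀ i : (Σ x : {x // x ∈ RetW X.Fact w}, Fin x.1.length), ∃ p : ℝ × ℝ, p.1 < p.2 ∧
      (X.P ^ (i.2 : ℕ)) '' Ico (D.a i.1) (D.b i.1) = Ico p.1 p.2 :=
    fun i => D.floor i.1 i.2 i.2.2.le
  choose p hp1 hp2 using key
  have hZ : ∀ z, z ∈ D.Z ↔ ∃ i, z ∈ Ico (p i).1 (p i).2 := by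
    intro z
    constructor
    · intro hz
      obtain ⟨x, n, hn, y, hy, h⟩ := D.Z_tower hz
      refine ⟨⟨x, ⟨n, hn⟩⟩, ?_⟩
      rw [← hp2]
      exact ⟨y, hy, h⟩
    · rintro ⟨i, hi⟩
      rw [← hp2] at hi
      obtain ⟨y, hy, rfl⟩ := hi
      refine ⟨-((i.2 : ℕ) : ℤ), ?_⟩
      rw [zpow_neg, zpow_natCast]
      simpa using (D.mem_K.mp hy).1
  apply ((finite_range fun i => (p i).1).union (finite_range fun i => (p i).2)).subset
  rintro e ⟨-, he⟩
  by_contra hno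
  simp only [mem_union, mem_range, not_or, not_exists] at hno
  apply he
  have := Filter.eventually_all.mpr fun i =>
    Ico_loc (fun h => hno.1 i h.symm) (fun h => hno.2 i h.symm)
  filter_upwards [this] with y hy
  rw [hZ, hZ]
  exact exists_congr hy

theorem E_step {e : ℝ} {j : Fin s} (he : e ∈ Ioo (X.γ j.castSucc) (X.γ j.succ)) :
    e ∈ D.E ↔ X.P e ∈ D.E := by
  have heI : e ∈ X.I j := Ioo_subset_Ico_self he
  have h1 : e ∈ Ioo X.l X.r := ⟨(X.sep_mem j).1.trans_lt he.1, (X.I_subset j heI).2⟩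
  have h2 : X.P e ∈ Ioo X.l X.r := by
    refine ⟨?_, (X.P_mem (X.I_subset j heI)).2⟩
    have h3 := (X.P_mem (X.sep_mem j)).1
    rw [X.P_I (X.sep_mem_I j)] at h3
    rw [X.P_I heI]
    have : X.sep j < e := he.1
    linarith
  have h4 : (∀ᶠ y in nhds e, (y ∈ D.Z ↔ e ∈ D.Z)) ↔
      ∀ᶠ y in nhds (X.P e), (y ∈ D.Z ↔ X.P e ∈ D.Z) := by
    rw [X.P_I heI, ← map_add_right_nhds, Filter.eventually_map, ← X.P_I heI]
    apply Filter.eventually_congr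
    filter_upwards [Ioo_mem_nhds he.1 he.2] with y hy
    rw [← X.P_I (Ioo_subset_Ico_self hy), D.Z_inv, D.Z_inv]
  unfold E
  simp only [mem_ofPred_eq, h1, h2, true_and, h4]

theorem no_finite_orbit {A : Set ℝ} (hA : A.Finite) (hs : 2 ≤ s) (hreg : X.Regular) {e : ℝ}
    (he : e ∈ Ico X.l X.r) (h : ∀ n : ℕ, (X.P ^ n) e ∈ A) : False := by
  have hni : ¬ Function.Injective fun n : ℕ => (X.P ^ n) e := by
    intro hinj
    exact (infinite_of_injective_forall_mem hinj h) hA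
  have : ∃ n m : ℕ, n < m ∧ (X.P ^ n) e = (X.P ^ m) e := by
    simp only [Function.Injective] at hni
    push Not at hni
    obtain ⟨n, m, h1, h2⟩ := hni
    rcases lt_or_gt_of_ne h2 with h3 | h3
    · exact ⟨n, m, h3, h1⟩
    · exact ⟨m, n, h3, h1.symm⟩
  obtain ⟨n, m, h1, h2⟩ := this
  exact X.no_periodic hs hreg he (by omega : 0 < m - n) (X.pow_cancel h2 h1.le).symm

theorem no_finite_orbit' {A : Set ℝ} (hA : A.Finite) (hs : 2 ≤ s) (hreg : X.Regular) {e : ℝ}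
    (he : e ∈ Ico X.l X.r) (h : ∀ n : ℕ, (X.P ^ n).symm e ∈ A) : False := by
  have hni : ¬ Function.Injective fun n : ℕ => (X.P ^ n).symm e := by
    intro hinj
    exact (infinite_of_injective_forall_mem hinj h) hA
  have : ∃ n m : ℕ, n < m ∧ (X.P ^ n).symm e = (X.P ^ m).symm e := by
    simp only [Function.Injective] at hni
    push Not at hni
    obtain ⟨n, m, h1, h2⟩ := hni
    rcases lt_or_gt_of_ne h2 with h3 | h3
    · exact ⟨n, m, h3, h1⟩
    · exact ⟨m, n, h3, h1.symm⟩
  obtain ⟨n, m, h1, h2⟩ := this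
  have h3 : (X.P ^ (m - n)) e = e := by
    have h4 : (X.P ^ m) ((X.P ^ n).symm e) = e := by rw [h2]; simp
    rw [← Nat.sub_add_cancel h1.le, pow_add, Equiv.Perm.mul_apply, Equiv.apply_symm_apply] at h4
    exact h4
  exact X.no_periodic hs hreg he (by omega : 0 < m - n) h3

theorem E_empty {e : ℝ} (he : e ∈ D.E) : False := by
  have heD : e ∈ Ico X.l X.r := Ioo_subset_Ico_self he.1
  -- forward orbit hits a nonzero separation point
  have hf : ∃ n : ℕ, ∃ i : Fin s, (i : ℕ) ≠ 0 ∧ (X.P ^ n) e = X.sep i := by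
    by_contra hno
    push Not at hno
    apply no_finite_orbit D.E_finite D.hs D.hreg heD
    intro n
    induction n with
    | zero => simpa using he
    | succ n ih =>
      obtain ⟨j, hj⟩ := X.exists_I (X.Ppow_mem heD n)
      rw [pow_succ', Equiv.Perm.mul_apply]
      refine (D.E_step (X.pred_sep hj ?_)).mp ih
      by_cases hj0 : (j : ℕ) = 0
      · rw [X.sep_zero j hj0]; exact ih.1.1.ne'
      · exact hno n j hj0
  have hb : ∃ n : ℕ, ∃ i : Fin s, (X.P ^ n).symm e = X.P (X.sep i) := by
    by_contra hno
    push Not at hno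
    apply no_finite_orbit' D.E_finite D.hs D.hreg heD
    intro n
    induction n with
    | zero => rw [pow_zero]; exact he
    | succ n ih =>
      have hn : (X.P ^ (n + 1)).symm e = X.P.symm ((X.P ^ n).symm e) := by
        rw [Equiv.symm_apply_eq, pow_succ, Equiv.Perm.mul_apply]; simp
      have hmem := X.P_symm_mem (Ioo_subset_Ico_self ih.1)
      obtain ⟨j, hj⟩ := X.exists_I hmem
      rw [hn]
      refine (D.E_step (X.pred_sep hj ?_)).mpr (by simpa using ih)
      intro h
      apply hno n j
      rw [← h]; simp
  obtain ⟨n, i, hi, h1⟩ := hf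
  obtain ⟨m, j, h2⟩ := hb
  obtain ⟨j', hj', k, hk⟩ := X.sep_orbit D.hs D.hreg j
  rw [Equiv.symm_apply_eq, ← hk] at h2
  have h3 : (X.P ^ (n + (m + (1 + k)))) (X.sep j') = X.sep i := by
    rw [pow_add, pow_add, pow_add, pow_one, Equiv.Perm.mul_apply, Equiv.Perm.mul_apply,
      Equiv.Perm.mul_apply, ← h2, h1]
  have := (X.reg_nat D.hreg hj' hi (n := 0) (by simpa using h3)).2
  omega

theorem Z_full {z : ℝ} (hz : z ∈ Ioo X.l X.r) : z ∈ D.Z := by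
  classical
  -- a point of J in the open interval
  have huD := X.Jw_subset w D.u_mem
  have hm : (D.u + D.v) / 2 ∈ X.Jw w := by
    rw [D.hJ]; have := D.huv; constructor <;> linarith
  have hmD : (D.u + D.v) / 2 ∈ Ioo X.l X.r := by
    refine ⟨?_, (X.Jw_subset w hm).2⟩
    have := D.huv; have := huD.1; linarith
  have hcont : ContinuousOn (fun z => decide (z ∈ D.Z)) (Ioo X.l X.r) := by
    intro e he
    apply ContinuousAt.continuousWithinAt
    have h1 : ∀ᶠ y in nhds e, (y ∈ D.Z ↔ e ∈ D.Z) := by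
      by_contra h
      exact D.E_empty ⟨he, h⟩
    have h2 : ∀ᶠ y in nhds e, (fun _ => decide (e ∈ D.Z)) y = decide (y ∈ D.Z) := by
      filter_upwards [h1] with y hy
      simp [hy]
    exact tendsto_const_nhds.congr' h2
  have h := isPreconnected_Ioo.constant hcont hz hmD
  have h3 : (D.u + D.v) / 2 ∈ D.Z := ⟨0, by simpa using hm⟩
  simpa [h3] using h

theorem phi_surj : ∃ φ : {x // x ∈ RetW X.Fact w} → Fin s, Function.Bijective φ ∧
    (∀ x, D.a x = D.u → (φ x : ℕ) = 0) ∧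
    (∀ x, D.a x ≠ D.u → (φ x : ℕ) ≠ 0 ∧ ∃ n < x.1.length, (X.P ^ n) (D.a x) = X.sep (φ x)) := by
  obtain ⟨φ, hφ, h0, h1⟩ := D.exists_phi
  refine ⟨φ, ⟨hφ, ?_⟩, h0, h1⟩
  intro i
  by_cases hi : (i : ℕ) = 0
  · obtain ⟨x, hx⟩ := D.returns D.u_mem
    refine ⟨x, ?_⟩
    have hax : D.a x = D.u := by
      apply le_antisymm hx.1
      have := (D.mem_K.mp (D.a_mem x)).1
      rw [D.hJ] at this
      exact this.1
    ext
    rw [h0 x hax, hi]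
  · obtain ⟨x, n, hn, y, hy, h⟩ := D.Z_tower (D.Z_full ⟨X.sep_gt i hi, (X.sep_mem i).2⟩)
    have hya : y = D.a x := by
      by_contra hne
      have hlt : D.a x < y := lt_of_le_of_ne hy.1 (Ne.symm hne)
      obtain ⟨t, ht⟩ := D.translate x n hn.le
      have ht1 := ht _ hy
      have ht2 := ht _ (D.a_mem x)
      -- both points are in the same letter interval
      have hw := (D.mem_K.mp hy).2
      have hw2 := (D.mem_K.mp (D.a_mem x)).2
      have hx : x.1 = x.1.take n ++ (x.1[n] :: x.1.drop (n + 1)) := by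
        rw [List.getElem_cons_drop, List.take_append_drop]
      have hlen : (x.1.take n).length = n := by rw [List.length_take]; omega
      rw [hx, mem_Iw_append, mem_Iw_cons, hlen] at hw hw2
      have hc := hw.2.1
      rw [h] at hc
      have := X.I_unique hc (X.sep_mem_I i)
      have h5 := hw2.2.1.1
      rw [this] at h5
      change X.sep i ≤ _ at h5
      rw [← h] at h5
      linarith
    have hau : D.a x ≠ D.u := by
      intro hau
      rw [hya, hau] at h
      exact D.u_not_hit hi h
    obtain ⟨hφ0, m, hm, hm2⟩ := h1 x hau
    refine ⟨x, ?_⟩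
    rw [hya] at h
    -- P^n a = sep i, P^m a = sep φ x
    have hmn : (X.P ^ n) (X.sep (φ x)) = (X.P ^ m) (X.sep i) := by
      rw [← hm2, ← h, ← Equiv.Perm.mul_apply, ← Equiv.Perm.mul_apply, ← pow_add, ← pow_add,
        add_comm]
    exact (X.reg_nat D.hreg hφ0 hi hmn).1

end Setup
end IET

namespace IET
namespace Setup
variable {s : ℕ} {X : IET s} {w : List (Fin s)} (D : Setup X w)

theorem fr_eq {x : {x // x ∈ RetW X.Fact w}} {z : ℝ} (hz : z ∈ Ico (D.a x) (D.b x)) :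
    X.firstReturn (X.Jw w) z = (X.P ^ x.1.length) z :=
  X.firstReturn_eq (D.mem_K.mp hz).1 x.2 (D.mem_K.mp hz).2

theorem fr_mem (D : Setup X w) {z : ℝ} (hz : z ∈ X.Jw w) :
    X.firstReturn (X.Jw w) z ∈ X.Jw w ∧
      ∃ n : ℕ, 0 < n ∧ X.firstReturn (X.Jw w) z = (X.P ^ n) z := by
  obtain ⟨x, hx⟩ := D.returns hz
  have h := D.K_ret hx
  refine ⟨?_, x.1.length, h.1, D.fr_eq hx⟩
  rw [D.fr_eq hx]; exact h.2.1

theorem fr_inj (D : Setup X w) {p q : ℝ} (hp : p ∈ X.Jw w) (hq : q ∈ X.Jw w)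
    (h : X.firstReturn (X.Jw w) p = X.firstReturn (X.Jw w) q) : p = q := by
  obtain ⟨x, hx⟩ := D.returns hp
  obtain ⟨y, hy⟩ := D.returns hq
  rw [D.fr_eq hx, D.fr_eq hy] at h
  have h3 := D.K_ret hx
  have h4 := D.K_ret hy
  rcases lt_trichotomy x.1.length y.1.length with h1 | h1 | h1
  · have h2 := X.pow_cancel h h1.le
    rw [h2] at hp
    exact absurd hp (h4.2.2 _ (by omega) (by omega))
  · rw [h1] at h; exact (X.P ^ _).injective h
  · have h2 := X.pow_cancel h.symm h1.le
    rw [h2] at hq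
    exact absurd hq (h3.2.2 _ (by omega) (by omega))

theorem exists_S : ∃ (S : IET s) (σ : Fin s ≃ {x // x ∈ RetW X.Fact w}), S.l = D.u ∧ S.r = D.v ∧
    (∀ z ∈ X.Jw w, S.T z = X.firstReturn (X.Jw w) z) ∧
    (∀ k, S.sep k = D.a (σ k)) ∧ (∀ k z, z ∈ S.I k ↔ z ∈ Ico (D.a (σ k)) (D.b (σ k))) := by
  classical
  obtain ⟨φ, hφ, -⟩ := D.phi_surj
  have hs := D.hs
  let φe := Equiv.ofBijective φ hφ
  let g : Fin s → ℝ := fun k => D.a (φe.symm k)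
  have hg : Function.Injective g := D.a_inj.comp φe.symm.injective
  let σ : Fin s ≃ {x // x ∈ RetW X.Fact w} := (Tuple.sort g).trans φe.symm
  have hσ : StrictMono fun k => D.a (σ k) :=
    (Tuple.monotone_sort g).strictMono_of_injective (hg.comp (Tuple.sort g).injective)
  have haJ : ∀ x, D.a x ∈ Ico D.u D.v := fun x => by
    rw [← D.hJ]; exact (D.mem_K.mp (D.a_mem x)).1
  let γ : Fin (s + 1) → ℝ := fun i => if h : (i : ℕ) < s then D.a (σ ⟨i, h⟩) else D.v
  have hγc : ∀ k : Fin s, γ k.castSucc = D.a (σ k) := fun k => by simp [γ]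
  have hγ : StrictMono γ := by
    intro i j hij
    have hi : (i : ℕ) < s := by have := j.2; have : (i : ℕ) < j := hij; omega
    by_cases hj : (j : ℕ) < s
    · simp only [γ, hi, hj, dif_pos]
      exact hσ (by rw [Fin.lt_def]; exact hij)
    · simp only [γ, hi, hj, dif_pos]
      exact (haJ _).2
  have hγ0 : γ 0 = D.u := by
    have h0 : (0 : ℕ) < s := by omega
    have : γ 0 = D.a (σ ⟨0, h0⟩) := by simp [γ, h0]
    rw [this]
    apply le_antisymm _ (haJ _).1
    obtain ⟨x, hx⟩ := D.returns D.u_mem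
    obtain ⟨k, rfl⟩ := σ.surjective x
    refine le_trans (hσ.monotone ?_) hx.1
    rw [Fin.le_def]; simp
  have hγl : γ (Fin.last s) = D.v := by simp [γ]
  have hI : ∀ k z, z ∈ Ico (γ k.castSucc) (γ k.succ) ↔ z ∈ Ico (D.a (σ k)) (D.b (σ k)) := by
    intro k z
    rw [hγc]
    constructor
    · rintro ⟨h1, h2⟩
      have hz : z ∈ X.Jw w := by
        rw [D.hJ]
        refine ⟨(haJ _).1.trans h1, h2.trans_le ?_⟩
        rw [← hγl]; exact hγ.monotone (Fin.le_last _)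
      obtain ⟨x, hx⟩ := D.returns hz
      obtain ⟨j, rfl⟩ := σ.surjective x
      rcases lt_trichotomy j k with h | h | h
      · have h3 := hσ h
        have := D.K_unique (x := σ j) (y := σ k) (z := D.a (σ k))
          ⟨h3.le, h1.trans_lt hx.2⟩ (D.a_mem _)
        exact absurd (σ.injective this) h.ne
      · rw [← h]; exact hx
      · have h3 : γ k.succ ≤ γ j.castSucc := hγ.monotone (by
          rw [Fin.le_def]; simp; exact h)
        rw [hγc] at h3
        exact absurd (h2.trans_le (h3.trans hx.1)) (lt_irrefl _)
    · rintro ⟨h1, h2⟩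
      refine ⟨h1, ?_⟩
      by_cases hk : (k : ℕ) + 1 < s
      · have : γ k.succ = D.a (σ ⟨k + 1, hk⟩) := by simp [γ, hk]
        rw [this]
        by_contra hle
        push Not at hle
        have hlt : k < ⟨k + 1, hk⟩ := by rw [Fin.lt_def]; simp
        have := D.K_unique (x := σ k) (y := σ ⟨k + 1, hk⟩) (z := D.a (σ ⟨k + 1, hk⟩))
          ⟨(hσ hlt).le, hle.trans_lt h2⟩ (D.a_mem _)
        exact absurd (σ.injective this) hlt.ne
      · have : γ k.succ = D.v := by simp [γ, hk]
        rw [this]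
        have := (D.mem_K.mp ⟨h1, h2⟩).1
        rw [D.hJ] at this
        exact this.2
  choose α hα using fun k => D.translate (σ k) (σ k).1.length le_rfl
  have hT : ∀ k, ∀ z ∈ Ico (γ k.castSucc) (γ k.succ), X.firstReturn (X.Jw w) z = z + α k := by
    intro k z hz
    rw [hI] at hz
    rw [D.fr_eq hz, hα k z hz]
  have hsurj : ∀ z ∈ X.Jw w, ∃ y ∈ X.Jw w, X.firstReturn (X.Jw w) y = z := by
    intro z hz
    obtain ⟨x, y, hy, h⟩ := D.back hz
    exact ⟨y, (D.mem_K.mp hy).1, by rw [D.fr_eq hy, h]⟩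
  choose! ti hti1 hti2 using hsurj
  let δ : Fin s → ℝ := fun k => γ k.castSucc + α k
  have hδ : Function.Injective δ := by
    intro i j hij
    have h1 : ∀ k, δ k = X.firstReturn (X.Jw w) (D.a (σ k)) := by
      intro k
      rw [hT k (D.a (σ k)) ((hI k _).mpr (D.a_mem _)), ← hγc]
    rw [h1, h1] at hij
    have h2 := D.fr_inj (D.mem_K.mp (D.a_mem _)).1 (D.mem_K.mp (D.a_mem _)).1 hij
    exact σ.injective (D.a_inj h2)
  refine ⟨{ l := D.u, r := D.v, hlr := D.huv, γ := γ, γ_mono := hγ, γ_first := hγ0, γ_last := hγl,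
            α := α, π := (Tuple.sort δ).symm, T := X.firstReturn (X.Jw w), Tinv := ti, hT := hT,
            hmaps := ?_, hinv_left := ?_, hinv_right := ?_, hinvmaps := ?_, himg_mono := ?_ },
          σ, rfl, rfl, fun _ _ => rfl, hγc, hI⟩
  · rw [← D.hJ]; exact fun z hz => (D.fr_mem hz).1
  · rw [← D.hJ]; intro z hz
    exact D.fr_inj (hti1 _ (D.fr_mem hz).1) hz (hti2 _ (D.fr_mem hz).1)
  · rw [← D.hJ]; exact hti2
  · rw [← D.hJ]; exact hti1
  · exact (Tuple.monotone_sort δ).strictMono_of_injective (hδ.comp (Tuple.sort δ).injective)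

end Setup

section induced
variable {s : ℕ} {X : IET s} {w : List (Fin s)} (D : Setup X w) (S : IET s)

theorem S_pow (D : Setup X w) (hJ : Ico S.l S.r = X.Jw w)
    (hT : ∀ z ∈ X.Jw w, S.T z = X.firstReturn (X.Jw w) z) {z : ℝ} (hz : z ∈ X.Jw w) (n : ℕ) :
    ∃ k : ℕ, n ≤ k ∧ (S.P ^ n) z = (X.P ^ k) z := by
  induction n with
  | zero => exact ⟨0, le_rfl, rfl⟩
  | succ n ih =>
    obtain ⟨k, hk, h⟩ := ih
    have hm := S.Ppow_mem (hJ ▸ hz) n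
    have hm2 := hm
    rw [hJ] at hm2
    obtain ⟨-, m, hm0, h2⟩ := D.fr_mem hm2
    refine ⟨m + k, by omega, ?_⟩
    rw [pow_succ', Equiv.Perm.mul_apply, S.P_apply hm, hT _ hm2, h2, h, pow_add,
      Equiv.Perm.mul_apply]

theorem S_zpow (D : Setup X w) (hJ : Ico S.l S.r = X.Jw w)
    (hT : ∀ z ∈ X.Jw w, S.T z = X.firstReturn (X.Jw w) z) {z : ℝ} (hz : z ∈ X.Jw w) (n : ℤ) :
    ∃ k : ℤ, (S.P ^ n) z = (X.P ^ k) z := by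
  rcases le_total 0 n with h | h
  · obtain ⟨k, -, hk⟩ := S_pow S D hJ hT hz n.toNat
    refine ⟨k, ?_⟩
    rw [zpow_natCast, ← hk, ← zpow_natCast, Int.toNat_of_nonneg h]
  · have hm := S.Pzpow_mem (hJ ▸ hz) n
    rw [hJ] at hm
    obtain ⟨k, -, hk⟩ := S_pow S D hJ hT hm (-n).toNat
    rw [← zpow_natCast, Int.toNat_of_nonneg (by omega), ← Equiv.Perm.mul_apply, ← zpow_add,
      neg_add_cancel, zpow_zero, Equiv.Perm.one_apply, ← zpow_natCast] at hk
    refine ⟨-(k : ℤ), ?_⟩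
    apply (X.P ^ (k : ℤ)).injective
    rw [← hk, ← Equiv.Perm.mul_apply, ← zpow_add, add_neg_cancel, zpow_zero, Equiv.Perm.one_apply]

theorem S_no_periodic (D : Setup X w) (hJ : Ico S.l S.r = X.Jw w)
    (hT : ∀ z ∈ X.Jw w, S.T z = X.firstReturn (X.Jw w) z) {z : ℝ} (hz : z ∈ X.Jw w) {m n : ℤ}
    (hmn : m < n) : (S.P ^ m) z ≠ (S.P ^ n) z := by
  intro h
  obtain ⟨k, hk, h2⟩ := S_pow S D hJ hT hz (n - m).toNat
  have h3 : (S.P ^ (n - m).toNat) z = z := by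
    apply (S.P ^ m).injective
    rw [h, ← zpow_natCast, ← Equiv.Perm.mul_apply, ← zpow_add]
    congr 2; omega
  rw [h3] at h2
  exact X.no_periodic D.hs D.hreg (X.Jw_subset w hz) (by omega : 0 < k) h2.symm

theorem S_regular (hl : S.l = D.u) (hJ : Ico S.l S.r = X.Jw w)
    (hT : ∀ z ∈ X.Jw w, S.T z = X.firstReturn (X.Jw w) z)
    (σ : Fin s ≃ {x // x ∈ RetW X.Fact w}) (hsep : ∀ k, S.sep k = D.a (σ k)) : S.Regular := by
  obtain ⟨φ, hφ, -, h1⟩ := D.phi_surj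
  intro i j hi hj m n h
  have hiJ := S.sep_mem i
  have hjJ := S.sep_mem j
  rw [S.iter_eq hiJ, S.iter_eq hjJ] at h
  rw [hJ] at hiJ hjJ
  have key : ∀ i : Fin s, (i : ℕ) ≠ 0 → (φ (σ i) : ℕ) ≠ 0 ∧
      ∃ c : ℤ, S.sep i = (X.P ^ c) (X.sep (φ (σ i))) := by
    intro i hi
    have h2 := S.sep_gt i hi
    rw [hl, hsep] at h2
    obtain ⟨h3, c, -, hc⟩ := h1 (σ i) h2.ne'
    refine ⟨h3, -(c : ℤ), ?_⟩
    rw [hsep, ← hc, ← zpow_natCast, ← Equiv.Perm.mul_apply, ← zpow_add, neg_add_cancel, zpow_zero,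
      Equiv.Perm.one_apply]
  obtain ⟨hi0, c, hc⟩ := key i hi
  obtain ⟨hj0, d, hd⟩ := key j hj
  obtain ⟨A, hA⟩ := S_zpow S D hJ hT hiJ m
  obtain ⟨B, hB⟩ := S_zpow S D hJ hT hjJ n
  have h2 := h
  rw [hA, hB, hc, hd, ← Equiv.Perm.mul_apply, ← Equiv.Perm.mul_apply, ← zpow_add, ← zpow_add] at h2
  have hij : i = j := σ.injective (hφ.1 (X.reg_P D.hreg hi0 hj0 h2).1)
  subst hij
  refine ⟨rfl, ?_⟩
  rcases lt_trichotomy m n with h3 | h3 | h3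
  · exact absurd h (S_no_periodic S D hJ hT hiJ h3)
  · exact h3
  · exact absurd h.symm (S_no_periodic S D hJ hT hiJ h3)

theorem S_Iw (hJ : Ico S.l S.r = X.Jw w)
    (hT : ∀ z ∈ X.Jw w, S.T z = X.firstReturn (X.Jw w) z)
    (σ : Fin s ≃ {x // x ∈ RetW X.Fact w})
    (hI : ∀ k z, z ∈ S.I k ↔ z ∈ Ico (D.a (σ k)) (D.b (σ k)))
    {B : Type} (f : B → List (Fin s)) (β : B ≃ Fin s) (hβ : ∀ b, (σ (β b)).1 = f b)
    (v : List B) (z : ℝ) :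
    z ∈ S.Iw (v.map β) ↔ z ∈ X.Jw w ∧ z ∈ X.Iw (v.flatMap f) := by
  induction v generalizing z with
  | nil =>
    change z ∈ Ico S.l S.r ↔ z ∈ X.Jw w ∧ z ∈ Ico X.l X.r
    rw [hJ]
    exact ⟨fun h => ⟨h, X.Jw_subset w h⟩, fun h => h.1⟩
  | cons b v ih =>
    rw [List.map_cons, List.flatMap_cons, mem_Iw_append, mem_Iw_cons, ih, hI]
    have hPz : z ∈ Ico (D.a (σ (β b))) (D.b (σ (β b))) → S.P z = (X.P ^ (f b).length) z := by
      intro hz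
      have hzJ := (D.mem_K.mp hz).1
      rw [S.P_apply (hJ ▸ hzJ), hT z hzJ, D.fr_eq hz, hβ]
    constructor
    · rintro ⟨h1, h2, h3⟩
      rw [hPz h1] at h3
      have h4 := D.mem_K.mp h1
      rw [hβ] at h4
      exact ⟨h4.1, h4.2, h3⟩
    · rintro ⟨h1, h2, h3⟩
      have h4 : z ∈ Ico (D.a (σ (β b))) (D.b (σ (β b))) := by
        rw [D.mem_K, hβ]; exact ⟨h1, h2⟩
      refine ⟨h4, ?_⟩
      rw [hPz h4]
      have h5 := (D.K_ret h4).2.1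
      rw [hβ] at h5
      exact ⟨h5, h3⟩

end induced

theorem derived_one (X : IET 1) (hreg : X.Regular)
    (w : List (Fin 1)) (B : Type) (f : B → List (Fin 1))
    (hinj : Function.Injective f) (hrange : Set.range f = IET.RetW X.Fact w) :
    ∃ (S : IET 1) (β : B ≃ Fin 1), S.Regular ∧ Set.Ico S.l S.r = X.Jw w ∧
      (∀ z ∈ X.Jw w, S.T z = X.firstReturn (X.Jw w) z) ∧
      ∀ v : List B, (w ++ v.flatMap f ∈ X.Fact) ↔ v.map β ∈ S.Fact := by
  have hl : X.l ∈ Ico X.l X.r := ⟨le_rfl, X.hlr⟩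
  have hI : ∀ z ∈ Ico X.l X.r, z ∈ X.I 0 := by
    intro z hz
    obtain ⟨i, hi⟩ := X.exists_I hz
    rwa [Subsingleton.elim i 0] at hi
  have hP : ∀ z ∈ Ico X.l X.r, X.P z = z := by
    have h1 := (X.P_mem hl).1
    rw [X.P_I (hI _ hl)] at h1
    have h2 := X.P_symm_mem hl
    have h3 := X.P_I (hI _ h2)
    rw [Equiv.apply_symm_apply] at h3
    have h4 := h2.1
    intro z hz
    rw [X.P_I (hI _ hz)]
    linarith
  have hPn : ∀ z ∈ Ico X.l X.r, ∀ n : ℕ, (X.P ^ n) z = z := by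
    intro z hz n
    induction n with
    | zero => rfl
    | succ n ih => rw [pow_succ, Equiv.Perm.mul_apply, hP z hz, ih]
  have hIw : ∀ x : List (Fin 1), ∀ z ∈ Ico X.l X.r, z ∈ X.Iw x := by
    intro x
    induction x with
    | nil => exact fun z hz => hz
    | cons b x ih =>
      intro z hz
      rw [mem_Iw_cons, hP z hz, Subsingleton.elim b 0]
      exact ⟨hI z hz, ih z hz⟩
  have hJ : ∀ z ∈ Ico X.l X.r, z ∈ X.Jw w := by
    intro z hz
    refine ⟨z, hIw w z hz, ?_⟩
    rw [X.T_iter hz, hPn z hz]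
  have hR : ∀ x, x ∈ RetW X.Fact w ↔ x = [0] := by
    intro x
    rw [X.retW_iff (hJ _ hl) (hIw x _ hl)]
    constructor
    · rintro ⟨h1, -, h2⟩
      have h3 : x.length = 1 := by
        by_contra hne
        refine h2 1 one_pos (by omega) ?_
        rw [hPn _ hl]; exact hJ _ hl
      obtain ⟨c, rfl⟩ := List.length_eq_one_iff.mp h3
      rw [Subsingleton.elim c 0]
    · rintro rfl
      refine ⟨by simp, ?_, ?_⟩
      · rw [hPn _ hl]; exact hJ _ hl
      · intro m h1 h2; simp at h2; omega
  have hfb : ∀ b, f b = [0] := fun b => (hR _).mp (hrange ▸ mem_range_self b)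
  obtain ⟨b0, -⟩ : ([0] : List (Fin 1)) ∈ range f := by rw [hrange, hR]
  have hsub : ∀ b, b = b0 := fun b => hinj ((hfb b).trans (hfb b0).symm)
  refine ⟨X, ⟨fun _ => 0, fun _ => b0, fun b => (hsub b).symm, fun _ => Subsingleton.elim _ _⟩,
    hreg, ?_, ?_, ?_⟩
  · exact Subset.antisymm hJ (X.Jw_subset w)
  · intro z hz
    have hzD := X.Jw_subset w hz
    rw [X.firstReturn_eq hz ((hR [0]).mpr rfl) (hIw _ z hzD), ← X.P_apply hzD]
    simp
  · intro v
    exact ⟨fun _ => ⟨X.l, hIw _ _ hl⟩, fun _ => ⟨X.l, hIw _ _ hl⟩⟩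

end IET

/-- the derived set of a regular `s`-interval exchange set with
respect to a coding morphism `f` for the first return words `R_F(w)` equals
(up to the bijection `β` of the alphabets) the factor set `F(S)` of the first
return map `S` of `T` on `J_w`, and `S` is a regular `s`-interval exchange
transformation. -/
theorem iet_derived_set_is_iet_set {s : ℕ} (X : IET s) (hreg : X.Regular)
    (w : List (Fin s)) (hw : w ∈ X.Fact) (B : Type) (f : B → List (Fin s))
    (hinj : Function.Injective f) (hrange : Set.range f = IET.RetW X.Fact w) :
    ∃ (S : IET s) (β : B ≃ Fin s), S.Regular ∧ Set.Ico S.l S.r = X.Jw w ∧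
      (∀ z ∈ X.Jw w, S.T z = X.firstReturn (X.Jw w) z) ∧
      ∀ v : List B, (w ++ v.flatMap f ∈ X.Fact) ↔ v.map β ∈ S.Fact := by
  rcases Nat.lt_or_ge s 2 with hs | hs
  · interval_cases s
    · exfalso
      have h1 := X.γ_first
      have h2 := X.γ_last
      have h3 := X.hlr
      rw [← h1, ← h2] at h3
      exact absurd h3 (lt_irrefl _)
    · exact IET.derived_one X hreg w B f hinj hrange
  · obtain ⟨D⟩ := X.exists_setup hs hreg w hw
    obtain ⟨S, σ, hl, hr, hT, hsep, hI⟩ := D.exists_S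
    have hJ : Ico S.l S.r = X.Jw w := by rw [hl, hr, D.hJ]
    have hmem : ∀ b, f b ∈ IET.RetW X.Fact w := fun b => hrange ▸ mem_range_self b
    let e : B ≃ {x // x ∈ IET.RetW X.Fact w} := Equiv.ofBijective (fun b => ⟨f b, hmem b⟩) (by
      constructor
      · intro b c h
        exact hinj (congrArg Subtype.val h)
      · rintro ⟨x, hx⟩
        have hx' := hx
        rw [← hrange] at hx'
        obtain ⟨b, hb⟩ := hx'
        exact ⟨b, Subtype.ext hb⟩)
    refine ⟨S, e.trans σ.symm, IET.S_regular D S hl hJ hT σ hsep, hJ, hT, ?_⟩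
    intro v
    rw [X.fact_append_iff]
    have h := IET.S_Iw D S hJ hT σ hI f (e.trans σ.symm) (by
      intro b
      rw [Equiv.trans_apply, Equiv.apply_symm_apply]
      rfl) v
    exact exists_congr fun z => (h z).symm
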